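/- arXiv:1607.02247 — 5 statements merged into one kernel-verified Lean document; each statement's English description precedes it below -/
import Mathlib

section
/- (Theorem C) Let p be an odd prime and let H be a special Miller p-group such that H^p < H' (strict containment) and the map H/H' → H' sending hH' to h^p is injective. Let M ≤ H' be a subgroup of order p with M not contained in H^p. Let G be a finite group containing H as a subgroup together with an element z of order p² which commutes with every element of H, such that G = H⟨z⟩ and H ∩ ⟨z⟩ = M (so M = ⟨z^p⟩). If the quotient H/M is a special Miller p-group, then G is a Miller group, i.e. G is non-abelian and Aut(G) is abelian; moreover G' = Φ(G) < Z(G), so G is non-special. -/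
open scoped commutatorElement

theorem aux_mul_pow {G : Type*} [Group G] (x y c : G) (hc : ∀ g, Commute c g)
    (hxy : y * x = c * (x * y)) (n : ℕ) : (x * y) ^ n = c ^ (n * (n - 1) / 2) * (x ^ n * y ^ n) := by
  have h1 : ∀ n : ℕ, y ^ n * x = c ^ n * (x * y ^ n) := by
    intro n
    induction n with
    | zero => simp
    | succ k ih =>
      calc y ^ (k+1) * x = y ^ k * (y * x) := by group
        _ = y ^ k * c * (x * y) := by rw [hxy]; group
        _ = c * (y ^ k * x) * y := by rw [← (hc (y ^ k)).eq]; group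
        _ = c * (c ^ k * (x * y ^ k)) * y := by rw [ih]
        _ = _ := by rw [pow_succ' c, pow_succ y]; simp only [mul_assoc]
  induction n with
  | zero => simp
  | succ k ih =>
    have e : (k + 1) * (k + 1 - 1) / 2 = k * (k - 1) / 2 + k := by
      rw [← Finset.sum_range_id_mul_two, ← Finset.sum_range_id_mul_two,
        Nat.mul_div_cancel _ (by norm_num), Nat.mul_div_cancel _ (by norm_num),
        Finset.sum_range_succ]
    rw [e, pow_succ, ih]
    have h2 : y ^ k * x = c ^ k * (x * y ^ k) := h1 k
    have h3 : x ^ k * c ^ k = c ^ k * x ^ k := (((hc (x ^ k)).pow_left k).eq).symm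
    calc c ^ (k * (k - 1) / 2) * (x ^ k * y ^ k) * (x * y)
        = c ^ (k * (k - 1) / 2) * (x ^ k * (y ^ k * x) * y) := by simp only [mul_assoc]
      _ = c ^ (k * (k - 1) / 2) * ((x ^ k * c ^ k) * (x * y ^ k) * y) := by
          rw [h2]; simp only [mul_assoc]
      _ = _ := by rw [h3, pow_add, pow_succ x, pow_succ y]; simp only [mul_assoc]

theorem aux_comm {G : Type*} [Group G] (k l u v : G) (hu : ∀ g, g * u = u * g)
    (hv : ∀ g, g * v = v * g) : ⁅k * u, l * v⁆ = ⁅k, l⁆ := by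
  have e1 : k * u * (l * v) = (k * l) * (u * v) := by
    rw [mul_assoc, ← mul_assoc u, ← hu l]; simp only [mul_assoc]
  have e2 : l * v * (k * u) = (l * k) * (u * v) := by
    rw [mul_assoc, ← mul_assoc v, ← hv k, hv u]; simp only [mul_assoc]
  rw [commutatorElement_def, commutatorElement_def]
  have : k * u * (l * v) * (l * v * (k * u))⁻¹ = k * l * (l * k)⁻¹ := by
    rw [e1, e2]; group
  simpa [mul_assoc] using this

/-- Frattini subgroup when `G'` is central and `G/G'` is elementary abelian. -/
theorem aux_frattini {G : Type*} [Group G] [Finite G] (p : ℕ) (hp : p.Prime)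
    (hc : commutator G ≤ Subgroup.center G) (hpw : ∀ g : G, g ^ p ∈ commutator G) :
    commutator G = frattini G := by
  apply le_antisymm
  · unfold frattini Order.radical
    refine le_iInf₂ fun K hK => ?_
    by_contra hn
    have htop : K ⊔ Subgroup.center G = ⊤ :=
      hK.2 _ (lt_of_le_of_ne le_sup_left fun e => hn (hc.trans (e ▸ le_sup_right)))
    apply hn
    rw [commutator_def, Subgroup.commutator_le]
    intro a _ b _
    have ha : a ∈ K ⊔ Subgroup.center G := htop ▸ Subgroup.mem_top a
    have hb : b ∈ K ⊔ Subgroup.center G := htop ▸ Subgroup.mem_top b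
    obtain ⟨k, hk, u, hu, rfl⟩ := Subgroup.mem_sup_of_normal_right.1 ha
    obtain ⟨l, hl, v, hv, rfl⟩ := Subgroup.mem_sup_of_normal_right.1 hb
    rw [Subgroup.mem_center_iff] at hu hv
    have := aux_comm k l u v hu hv
    rw [this, commutatorElement_def]
    exact K.mul_mem (K.mul_mem (K.mul_mem hk hl) (K.inv_mem hk)) (K.inv_mem hl)
  · intro g hg
    by_contra hgD
    obtain ⟨K, hK⟩ := (Set.toFinite {K : Subgroup G | commutator G ≤ K ∧ g ∉ K}).exists_maximal
      ⟨_, le_rfl, hgD⟩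
    obtain ⟨⟨hDK, hgK⟩, hmax⟩ := hK
    have hKn : K.Normal := Subgroup.Normal.of_commutator_le G hDK
    have key : ∀ x, x ∉ K → ∃ k ∈ K, ∃ i : ℤ, k * x ^ i = g := by
      intro x hx
      have : g ∈ K ⊔ Subgroup.zpowers x := by
        by_contra h
        exact hx (hmax (y := K ⊔ Subgroup.zpowers x) ⟨hDK.trans le_sup_left, h⟩ le_sup_left
          (Subgroup.mem_sup_right (Subgroup.mem_zpowers x)))
      obtain ⟨k, hk, u, ⟨i, rfl⟩, h⟩ := Subgroup.mem_sup_of_normal_left.1 this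
      exact ⟨k, hk, i, h⟩
    have hco : IsCoatom K := by
      refine ⟨fun h => hgK (h ▸ Subgroup.mem_top g), fun L hL => ?_⟩
      have hgL : g ∈ L := by
        obtain ⟨x, hxL, hxK⟩ := SetLike.exists_of_lt hL
        obtain ⟨k, hk, i, rfl⟩ := key x hxK
        exact L.mul_mem (hL.le hk) (L.zpow_mem hxL i)
      rw [eq_top_iff]
      intro x _
      by_cases hxK : x ∈ K
      · exact hL.le hxK
      obtain ⟨k, hk, i, hki⟩ := key x hxK
      have hxi : x ^ i ∈ L := by
        have : x ^ i = k⁻¹ * g := by rw [← hki]; group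
        rw [this]; exact L.mul_mem (L.inv_mem (hL.le hk)) hgL
      have hxp : x ^ (p : ℤ) ∈ K := by rw [zpow_natCast]; exact hDK (hpw x)
      have hndvd : ¬ (p : ℤ) ∣ i := by
        rintro ⟨j, rfl⟩
        apply hgK
        rw [← hki, zpow_mul]
        exact K.mul_mem hk (K.zpow_mem hxp j)
      have hcop : IsCoprime (p : ℤ) i :=
        (Prime.coprime_iff_not_dvd (Nat.prime_iff_prime_int.1 hp)).2 hndvd
      obtain ⟨a, b, hab⟩ := hcop
      have : x = (x ^ (p : ℤ)) ^ a * (x ^ i) ^ b := by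
        rw [← zpow_mul, ← zpow_mul, ← zpow_add, mul_comm (p : ℤ), mul_comm i, hab, zpow_one]
      rw [this]
      exact L.mul_mem (L.zpow_mem (hL.le hxp) a) (L.zpow_mem hxi b)
    exact hgK (frattini_le_coatom hco hg)

/-- Theorem C: if `H` is a special Miller `p`-group with `H^p < H'` and injective `p`-th power
map `H/H' → H'`, `M ≤ H'` has order `p` and `M ⊄ H^p`, `G = H⟨z⟩` with `z` of order `p²`
centralizing `H` and `H ∩ ⟨z⟩ = M`, and `H/M` is a special Miller `p`-group, then `G` is a
Miller group with `G' = Φ(G) < Z(G)` (so `G` is non-special). -/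
theorem stmt_11 (p : ℕ) (hp : p.Prime) (hodd : Odd p)
    (G : Type*) [Group G] [Finite G] (H : Subgroup G)
    -- `H` is a special Miller `p`-group
    (hHpgrp : IsPGroup p H)
    (hsp1 : Subgroup.center ↥H = commutator ↥H)
    (hsp2 : frattini ↥H = commutator ↥H)
    (hHnonab : ¬ ∀ x y : ↥H, x * y = y * x)
    (hHaut : ∀ φ ψ : MulAut ↥H, φ * ψ = ψ * φ)
    -- `H^p < H'`
    (hpow : Subgroup.closure {x : ↥H | ∃ g : ↥H, g ^ p = x} < commutator ↥H)
    -- the map `H/H' → H'`, `hH' ↦ h^p`, is injective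
    (hinj : ∀ x y : ↥H, x ^ p = y ^ p → x⁻¹ * y ∈ commutator ↥H)
    -- `M ≤ H'` of order `p`, `M ⊄ H^p`
    (M : Subgroup ↥H) [M.Normal]
    (hMle : M ≤ commutator ↥H) (hMcard : Nat.card M = p)
    (hMnot : ¬ M ≤ Subgroup.closure {x : ↥H | ∃ g : ↥H, g ^ p = x})
    -- `z` of order `p²` commuting with every element of `H`, `G = H⟨z⟩`, `H ∩ ⟨z⟩ = M`
    (z : G) (hz : orderOf z = p ^ 2)
    (hzcomm : ∀ h ∈ H, Commute z h)
    (hgen : H ⊔ Subgroup.zpowers z = ⊤)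
    (hint : H ⊓ Subgroup.zpowers z = M.map H.subtype)
    -- `H/M` is a special Miller `p`-group
    (hq1 : Subgroup.center (↥H ⧸ M) = commutator (↥H ⧸ M))
    (hq2 : frattini (↥H ⧸ M) = commutator (↥H ⧸ M))
    (hq3 : ¬ ∀ x y : ↥H ⧸ M, x * y = y * x)
    (hq4 : ∀ φ ψ : MulAut (↥H ⧸ M), φ * ψ = ψ * φ) :
    (¬ ∀ x y : G, x * y = y * x) ∧
    (∀ φ ψ : MulAut G, φ * ψ = ψ * φ) ∧
    commutator G = frattini G ∧
    frattini G < Subgroup.center G := by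
  have hzc : ∀ g : G, g * z = z * g := by
    intro g
    have hg : g ∈ H ⊔ Subgroup.zpowers z := hgen ▸ Subgroup.mem_top g
    have hle : H ⊔ Subgroup.zpowers z ≤ Subgroup.centralizer {z} := by
      refine sup_le (fun h hh => ?_) ?_
      · rw [Subgroup.mem_centralizer_singleton_iff]; exact (hzcomm h hh).eq.symm
      · rw [Subgroup.zpowers_le, Subgroup.mem_centralizer_singleton_iff]
    exact Subgroup.mem_centralizer_singleton_iff.1 (hle hg)
  have hzZ : z ∈ Subgroup.center G := Subgroup.mem_center_iff.2 hzc
  have hziZ : ∀ i : ℤ, z ^ i ∈ Subgroup.center G := fun i => Subgroup.zpow_mem _ hzZ i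
  have hZn : (Subgroup.zpowers z).Normal := by
    constructor
    rintro _ ⟨i, rfl⟩ g
    have := Subgroup.mem_center_iff.1 (hziZ i) g
    exact ⟨i, by simp only; rw [this]; group⟩
  have hdec : ∀ g : G, ∃ h : H, ∃ i : ℤ, (h : G) * z ^ i = g := by
    intro g
    have hg : g ∈ H ⊔ Subgroup.zpowers z := hgen ▸ Subgroup.mem_top g
    obtain ⟨k, hk, u, ⟨i, rfl⟩, h⟩ := Subgroup.mem_sup_of_normal_right.1 hg
    exact ⟨⟨k, hk⟩, i, h⟩
  -- central elements of H are central in G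
  have hcen : ∀ c : H, c ∈ commutator H → (c : G) ∈ Subgroup.center G := by
    intro c hc
    rw [← hsp1, Subgroup.mem_center_iff] at hc
    rw [Subgroup.mem_center_iff]
    intro g
    obtain ⟨h, i, rfl⟩ := hdec g
    have h1 : (h : G) * c = c * h := congrArg Subtype.val (hc h)
    have h2 := Subgroup.mem_center_iff.1 (hziZ i) c
    rw [mul_assoc, ← h2, ← mul_assoc, h1, mul_assoc]
  have hcen' : ∀ h : H, (h : G) ∈ Subgroup.center G → h ∈ commutator H := by
    intro h hh
    rw [← hsp1, Subgroup.mem_center_iff]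
    intro k
    exact Subtype.ext (Subgroup.mem_center_iff.1 hh k)
  have hDeq : (commutator H).map H.subtype = commutator G := by
    rw [Subgroup.map_subtype_commutator]
    refine le_antisymm (Subgroup.commutator_mono le_top le_top) ?_
    rw [commutator_def, Subgroup.commutator_le]
    intro a _ b _
    obtain ⟨h, i, rfl⟩ := hdec a
    obtain ⟨k, j, rfl⟩ := hdec b
    rw [aux_comm _ _ _ _ (Subgroup.mem_center_iff.1 (hziZ i)) (Subgroup.mem_center_iff.1 (hziZ j))]
    exact Subgroup.commutator_mem_commutator h.2 k.2
  have hD : ∀ c : H, c ∈ commutator H → (c : G) ∈ commutator G := by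
    intro c hc
    rw [← hDeq]
    exact ⟨c, hc, rfl⟩
  have hD' : ∀ g ∈ commutator G, ∃ c : H, c ∈ commutator H ∧ (c : G) = g := by
    intro g hg
    rw [← hDeq] at hg
    exact hg
  have hDZ : commutator G ≤ Subgroup.center G := by
    intro g hg
    obtain ⟨c, hc, rfl⟩ := hD' g hg
    exact hcen c hc
  have hM : ∀ m : H, m ∈ M ↔ (m : G) ∈ Subgroup.zpowers z := by
    intro m
    constructor
    · intro hm
      have : (m : G) ∈ M.map H.subtype := ⟨m, hm, rfl⟩
      rw [← hint] at this
      exact this.2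
    · intro hm
      have : (m : G) ∈ H ⊓ Subgroup.zpowers z := ⟨m.2, hm⟩
      rw [hint] at this
      obtain ⟨m', hm', e⟩ := this
      rwa [← Subtype.ext (show (m' : G) = m from e)]
  have hMp : ∀ m ∈ M, m ^ p = 1 := by
    intro m hm
    have : (⟨m, hm⟩ : M) ^ Nat.card M = 1 := pow_card_eq_one'
    rw [hMcard] at this
    exact congrArg Subtype.val this
  have hp0 : (p : ℤ) ≠ 0 := by exact_mod_cast hp.ne_zero
  have hpp := Nat.prime_iff_prime_int.1 hp
  have hzi : ∀ i : ℤ, (z ^ i) ^ p = 1 → (p : ℤ) ∣ i := by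
    intro i hi
    rw [← zpow_natCast, ← zpow_mul, ← orderOf_dvd_iff_zpow_eq_one, hz] at hi
    push_cast at hi
    rw [pow_two] at hi
    exact Int.dvd_of_mul_dvd_mul_right hp0 hi
  have hMz : ∀ m ∈ M, ∃ j : ℤ, (m : G) = (z ^ p) ^ j := by
    intro m hm
    obtain ⟨i, hi⟩ := (hM m).1 hm
    simp only at hi
    have h1 : (z ^ i) ^ p = 1 := by
      rw [hi]
      exact congrArg Subtype.val (hMp m hm)
    obtain ⟨j, rfl⟩ := hzi i h1
    exact ⟨j, by rw [← hi, zpow_mul, zpow_natCast]⟩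
  have hzpp : (z ^ p) ^ p = 1 := by
    rw [← pow_mul, ← pow_two, ← hz]; exact pow_orderOf_eq_one z
  have hzp : ∃ m ∈ M, (m : G) = z ^ p := by
    have hnt : Nontrivial M := by
      rw [← Finite.one_lt_card_iff_nontrivial, hMcard]; exact hp.one_lt
    obtain ⟨⟨m, hm⟩, hm1⟩ := exists_ne (1 : M)
    obtain ⟨j, hj⟩ := hMz m hm
    have hnd : ¬ (p : ℤ) ∣ j := by
      rintro ⟨k, rfl⟩
      apply hm1
      apply Subtype.ext
      apply Subtype.ext
      change (m : G) = 1
      rw [hj, zpow_mul, zpow_natCast, hzpp, one_zpow]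
    obtain ⟨a, b, hab⟩ := (Prime.coprime_iff_not_dvd hpp).2 hnd
    refine ⟨m ^ b, M.zpow_mem hm b, ?_⟩
    push_cast
    rw [hj, ← zpow_mul]
    conv_rhs => rw [← zpow_one (z ^ p), ← hab, zpow_add, mul_comm a, zpow_mul, zpow_natCast, hzpp,
      one_zpow, one_mul, mul_comm]
  have hzpD : z ^ p ∈ commutator G := by
    obtain ⟨m, hm, e⟩ := hzp
    rw [← e]
    exact hD m (hMle hm)
  have hHp : ∀ h : H, h ^ p ∈ commutator H := fun h =>
    hpow.le (Subgroup.subset_closure ⟨h, rfl⟩)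
  have hpG : ∀ (h : G) (i : ℤ), (h * z ^ i) ^ p = h ^ p * (z ^ p) ^ i := by
    intro h i
    have : Commute h (z ^ i) := Subgroup.mem_center_iff.1 (hziZ i) h
    rw [this.mul_pow]
    congr 1
    rw [← zpow_natCast, ← zpow_natCast, ← zpow_mul, ← zpow_mul, mul_comm]
  have hGp : ∀ g : G, g ^ p ∈ commutator G := by
    intro g
    obtain ⟨h, i, rfl⟩ := hdec g
    rw [hpG]
    exact Subgroup.mul_mem _ (hD (h ^ p) (hHp h)) (Subgroup.zpow_mem _ hzpD i)
  have hfr : commutator G = frattini G := aux_frattini p hp hDZ hGp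
  have hcz : ∀ x y : G, x ∈ Subgroup.center G → ⁅x, y⁆ = 1 := by
    intro x y hx
    rw [commutatorElement_eq_one_iff_mul_comm]
    exact (Subgroup.mem_center_iff.1 hx y).symm
  -- the power map is a homomorphism
  have hpm : ∀ x y : G, (x * y) ^ p = x ^ p * y ^ p := by
    intro x y
    have hcD : ⁅y, x⁆ ∈ Subgroup.center G :=
      hDZ (Subgroup.commutator_mem_commutator (Subgroup.mem_top y) (Subgroup.mem_top x))
    have hcc : ∀ g, Commute ⁅y, x⁆ g := fun g => (Subgroup.mem_center_iff.1 hcD g).symm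
    have hxy : y * x = ⁅y, x⁆ * (x * y) := by rw [commutatorElement_def]; group
    have hyn : ∀ n : ℕ, y ^ n * x = ⁅y, x⁆ ^ n * (x * y ^ n) := by
      intro n
      induction n with
      | zero => simp
      | succ k ih =>
        calc y ^ (k+1) * x = y ^ k * (y * x) := by rw [pow_succ, mul_assoc]
          _ = (y ^ k * ⁅y, x⁆) * (x * y) := by rw [mul_assoc, ← hxy]
          _ = ⁅y, x⁆ * (y ^ k * x) * y := by rw [← (hcc (y ^ k)).eq]; simp only [mul_assoc]
          _ = _ := by rw [ih, pow_succ', pow_succ y]; simp only [mul_assoc]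
    have hcp : ⁅y, x⁆ ^ p = 1 := by
      have h1 := hyn p
      have h2 := Subgroup.mem_center_iff.1 (hDZ (hGp y)) x
      rw [h2] at h1
      exact (mul_eq_right.1 h1.symm)
    rw [aux_mul_pow x y _ hcc hxy p]
    obtain ⟨k, hk⟩ := hodd
    have : p * (p - 1) / 2 = p * k := by
      have : p - 1 = k * 2 := by omega
      rw [this, ← mul_assoc]; exact Nat.mul_div_cancel _ (by norm_num)
    rw [this, pow_mul, hcp, one_pow, one_mul]
  have hker : ∀ x : G, x ^ p = 1 → x ∈ commutator G := by
    intro x hx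
    obtain ⟨h, i, rfl⟩ := hdec x
    rw [hpG] at hx
    have hhM : h ^ p ∈ M := by
      rw [hM]
      push_cast
      rw [eq_inv_of_mul_eq_one_left hx]
      exact Subgroup.inv_mem _ (Subgroup.zpow_mem _ (Subgroup.pow_mem _ (Subgroup.mem_zpowers z) _) _)
    have hh1 : h ^ p = 1 := by
      by_contra hne
      apply hMnot
      have hF : Fact p.Prime := ⟨hp⟩
      have hne' : (⟨h ^ p, hhM⟩ : M) ≠ 1 := fun e => hne (congrArg Subtype.val e)
      intro m hm
      have : (⟨m, hm⟩ : M) ∈ Subgroup.zpowers (⟨h ^ p, hhM⟩ : M) :=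
        mem_zpowers_of_prime_card hMcard hne'
      obtain ⟨k, hk⟩ := this
      have hk' : (h ^ p) ^ k = m := congrArg Subtype.val hk
      rw [← hk']
      exact Subgroup.zpow_mem _ (Subgroup.subset_closure (show _ ∈ {x : ↥H | ∃ g : ↥H, g ^ p = x} from ⟨h, rfl⟩)) k
    have hh : h ∈ commutator H := by
      have := hinj h 1 (by rw [hh1, one_pow])
      rw [mul_one] at this
      exact (Subgroup.inv_mem_iff _).1 this
    have hh1' : (h : G) ^ p = 1 := congrArg Subtype.val hh1
    rw [hh1', one_mul] at hx
    have hx' : (z ^ i) ^ p = 1 := by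
      rw [← hx, ← zpow_natCast, ← zpow_natCast, ← zpow_mul, ← zpow_mul, mul_comm]
    obtain ⟨j, rfl⟩ := hzi i hx'
    rw [zpow_mul, zpow_natCast]
    exact Subgroup.mul_mem _ (hD h hh) (Subgroup.zpow_mem _ hzpD j)
  have hDH : ∀ g ∈ commutator G, g ∈ H := by
    intro g hg
    obtain ⟨c, _, rfl⟩ := hD' g hg
    exact c.2
  have hDp : ∀ g ∈ commutator G, ∀ x : G, Commute g x := fun g hg x =>
    (Subgroup.mem_center_iff.1 (hDZ hg) x).symm
  have hφD : ∀ (φ : MulAut G) (g : G), g ∈ commutator G → φ g ∈ commutator G := by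
    intro φ g hg
    have : (commutator G).Characteristic := inferInstance
    rw [Subgroup.characteristic_iff_map_le] at this
    exact this φ ⟨g, hg, rfl⟩
  have hφZ : ∀ (φ : MulAut G) (g : G), g ∈ Subgroup.center G → φ g ∈ Subgroup.center G := by
    intro φ g hg
    have : (Subgroup.center G).Characteristic := inferInstance
    rw [Subgroup.characteristic_iff_map_le] at this
    exact this φ ⟨g, hg, rfl⟩
  have hcomp : ∀ c : H, c ∈ commutator H → c ^ p = 1 := by
    let P : G →* G := MonoidHom.mk' (fun g => g ^ p) hpm
    have hle : commutator G ≤ P.ker := by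
      rw [commutator_def, Subgroup.commutator_le]
      intro a _ b _
      rw [MonoidHom.mem_ker, map_commutatorElement]
      exact hcz _ _ (hDZ (hGp a))
    intro c hc
    exact Subtype.ext (hle (hD c hc))
  have hφM : ∀ (φ : MulAut G) (m : H), m ∈ M → φ (m : G) ∈ Subgroup.zpowers z := by
    intro φ m hm
    obtain ⟨j, hj⟩ := hMz m hm
    rw [hj, map_zpow, map_pow]
    obtain ⟨c, k, hck⟩ := hdec (φ z)
    have hc : (c : G) ∈ Subgroup.center G := by
      have : (c : G) = φ z * (z ^ k)⁻¹ := by rw [← hck]; group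
      rw [this]
      exact Subgroup.mul_mem _ (hφZ φ z hzZ) (Subgroup.inv_mem _ (hziZ k))
    have hc1 : (c : G) ^ p = 1 := congrArg Subtype.val (hcomp c (hcen' c hc))
    rw [← hck, hpG, hc1, one_mul]
    exact Subgroup.zpow_mem _ (Subgroup.zpow_mem _
      (Subgroup.pow_mem _ (Subgroup.mem_zpowers z) _) _) _
  -- every automorphism is central
  have hcentral : ∀ (φ : MulAut G) (g : G), g⁻¹ * φ g ∈ Subgroup.center G := by
    intro φ
    let j : H →* G ⧸ Subgroup.zpowers z := (QuotientGroup.mk' _).comp H.subtype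
    have hj1 : ∀ h : H, j h = 1 ↔ h ∈ M := by
      intro h
      rw [hM]
      exact QuotientGroup.eq_one_iff (h : G)
    let jb : H ⧸ M →* G ⧸ Subgroup.zpowers z :=
      QuotientGroup.lift M j (fun m hm => (hj1 m).2 hm)
    let k : H →* G ⧸ Subgroup.zpowers z :=
      (QuotientGroup.mk' _).comp (φ.toMonoidHom.comp H.subtype)
    have hk1 : ∀ h : H, k h = 1 ↔ φ (h : G) ∈ Subgroup.zpowers z := fun h =>
      QuotientGroup.eq_one_iff (φ (h : G))
    have hk2 : ∀ h : H, k h = 1 ↔ h ∈ M := by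
      intro h
      rw [hk1]
      refine ⟨fun hh => ?_, hφM φ h⟩
      have h1 : φ (h : G) ∈ Subgroup.center G := by
        obtain ⟨i, hi⟩ := hh
        rw [← hi]; exact hziZ i
      have h2 : (h : G) ∈ Subgroup.center G := by
        have := hφZ φ.symm _ h1
        simpa using this
      have h3 : φ (h : G) ∈ H := hDH _ (hφD φ _ (hD h (hcen' h h2)))
      have h4 : (⟨φ h, h3⟩ : H) ∈ M := (hM _).2 hh
      have h5 := hφM φ.symm _ h4
      rw [hM]
      simpa using h5
    let kb : H ⧸ M →* G ⧸ Subgroup.zpowers z :=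
      QuotientGroup.lift M k (fun m hm => (hk2 m).2 hm)
    have hjb : Function.Bijective jb := by
      constructor
      · rw [injective_iff_map_eq_one]
        intro a
        induction a using QuotientGroup.induction_on with
        | H h => 
          intro hh
          exact (QuotientGroup.eq_one_iff h).2 ((hj1 h).1 hh)
      · intro a
        induction a using QuotientGroup.induction_on with
        | H g => 
          obtain ⟨h, i, rfl⟩ := hdec g
          refine ⟨(h : H ⧸ M), ?_⟩
          change ((h : G) : G ⧸ Subgroup.zpowers z) = _
          rw [QuotientGroup.eq]
          exact ⟨i, by simp⟩
    have hkb : Function.Injective kb := by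
      rw [injective_iff_map_eq_one]
      intro a
      induction a using QuotientGroup.induction_on with
      | H h => 
        intro hh
        exact (QuotientGroup.eq_one_iff h).2 ((hk2 h).1 hh)
    let e : H ⧸ M ≃* G ⧸ Subgroup.zpowers z := MulEquiv.ofBijective jb hjb
    let f0 : H ⧸ M →* H ⧸ M := e.symm.toMonoidHom.comp kb
    have hf0 : Function.Injective f0 := e.symm.injective.comp hkb
    let f : MulAut (H ⧸ M) := MulEquiv.ofBijective f0 (Finite.injective_iff_bijective.1 hf0)
    have hfc : ∀ a : H ⧸ M, a⁻¹ * f a ∈ Subgroup.center (H ⧸ M) := by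
      intro a
      rw [Subgroup.mem_center_iff]
      intro b
      obtain ⟨y, rfl⟩ := f.surjective b
      have h1 := DFunLike.congr_fun (hq4 f (MulAut.conj a)) y
      simp only [MulAut.mul_apply, MulAut.conj_apply, map_mul, map_inv] at h1
      have h2 : f a * f y = a * f y * a⁻¹ * f a := by rw [← h1]; group
      rw [mul_assoc a⁻¹, h2]; group
    have hH : ∀ h : H, (h : G)⁻¹ * φ h ∈ Subgroup.center G := by
      intro h
      obtain ⟨k', hk'⟩ := QuotientGroup.mk_surjective (f (h : H ⧸ M))
      have h1 : (h : H ⧸ M)⁻¹ * (k' : H ⧸ M) ∈ commutator (H ⧸ M) := by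
        rw [← hq1, hk']; exact hfc h
      have h2 : kb (h : H ⧸ M) = jb (k' : H ⧸ M) := by
        rw [hk']
        exact (e.apply_symm_apply _).symm
      have h3 : ((k' : G) : G ⧸ Subgroup.zpowers z) = ((φ (h : G) : G) : G ⧸ Subgroup.zpowers z) :=
        h2.symm
      rw [QuotientGroup.eq] at h3
      have h4 : commutator (H ⧸ M) = (commutator H).map (QuotientGroup.mk' M) := by
        rw [commutator_def, commutator_def, Subgroup.map_commutator,
          ← MonoidHom.range_eq_map, MonoidHom.range_eq_top.2 (QuotientGroup.mk'_surjective M)]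
      rw [h4] at h1
      obtain ⟨c, hc, hce⟩ := h1
      have h5 : c⁻¹ * (h⁻¹ * k') ∈ M := by
        rw [← QuotientGroup.eq]
        exact hce
      have h6 : h⁻¹ * k' ∈ commutator H := by
        have := Subgroup.mul_mem _ hc (hMle h5)
        simpa using this
      have h7 := hcen _ h6
      have h8 : (k' : G)⁻¹ * φ h ∈ Subgroup.center G := by
        obtain ⟨i, hi⟩ := h3
        rw [← hi]; exact hziZ i
      have := Subgroup.mul_mem _ h7 h8
      push_cast at this
      simpa [mul_assoc] using this
    intro g
    obtain ⟨h, i, rfl⟩ := hdec g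
    have h1 := Subgroup.mul_mem _ (hH h)
      (Subgroup.mul_mem _ (hφZ φ _ (hziZ i)) (Subgroup.inv_mem _ (hziZ i)))
    have h2 := Subgroup.mem_center_iff.1 (Subgroup.inv_mem _ (hziZ i))
    have : ((h : G) * z ^ i)⁻¹ * φ ((h : G) * z ^ i)
        = (h : G)⁻¹ * φ h * (φ (z ^ i) * (z ^ i)⁻¹) := by
      rw [mul_inv_rev, map_mul, mul_assoc, ← h2]
      simp only [mul_assoc]
    rw [this]
    exact h1
  have hfix : ∀ (φ : MulAut G) (g : G), g ∈ commutator G → φ g = g := by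
    intro φ g hg
    have hle : commutator G ≤ (φ.toMonoidHom).eqLocus (MonoidHom.id G) := by
      rw [commutator_def, Subgroup.commutator_le]
      intro a _ b _
      change φ ⁅a, b⁆ = ⁅a, b⁆
      rw [map_commutatorElement]
      have ea : φ a = a * (a⁻¹ * φ a) := by group
      have eb : φ b = b * (b⁻¹ * φ b) := by group
      rw [ea, eb]
      exact aux_comm _ _ _ _ (Subgroup.mem_center_iff.1 (hcentral φ a))
        (Subgroup.mem_center_iff.1 (hcentral φ b))
    exact hle hg
  have hφ1 : ∀ (φ : MulAut G) (g : G), g⁻¹ * φ g ∈ commutator G := by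
    intro φ g
    apply hker
    rw [hpm, ← map_pow, hfix φ _ (hGp g), inv_pow, inv_mul_cancel]
  refine ⟨?_, ?_, hfr, ?_⟩
  · intro h
    exact hHnonab fun x y => Subtype.ext (h x y)
  · intro φ ψ
    ext g
    have ha := hφ1 φ g
    have hb := hφ1 ψ g
    have ea : φ g = g * (g⁻¹ * φ g) := by group
    have eb : ψ g = g * (g⁻¹ * ψ g) := by group
    change φ (ψ g) = ψ (φ g)
    have e1 : φ (ψ g) = φ g * (g⁻¹ * ψ g) := by
      conv_lhs => rw [eb, map_mul, hfix φ _ hb]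
    have e2 : ψ (φ g) = ψ g * (g⁻¹ * φ g) := by
      conv_lhs => rw [ea, map_mul, hfix ψ _ ha]
    rw [e1, e2]
    conv_lhs => rw [ea, mul_assoc, (hDp _ ha _).eq, ← mul_assoc, ← eb]
  · rw [← hfr]
    refine lt_of_le_of_ne hDZ fun e => ?_
    have hzH : z ∈ H := hDH z (e ▸ hzZ)
    have hzM : (⟨z, hzH⟩ : H) ∈ M := (hM _).2 (Subgroup.mem_zpowers z)
    have h1 : z ^ p = 1 := congrArg Subtype.val (hMp _ hzM)
    have h2 := orderOf_dvd_of_pow_eq_one h1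
    rw [hz] at h2
    have h3 := Nat.le_of_dvd hp.pos h2
    nlinarith [hp.one_lt]
end

section
/- Let p be a prime, let H be a finite Miller p-group, and let C be a cyclic group of order p. Then every automorphism of the direct product H × C is a central automorphism. -/
theorem exists_hom_aux (p : ℕ) (hp : p.Prime) (Q : Type*) [Group Q] [Finite Q] (hQ : IsPGroup p Q)
    [Nontrivial Q] (C : Type*) [Group C] (hC : Nat.card C = p) :
    ∃ f : Q →* C, ∃ q, f q ≠ 1 := by
  have : Fact p.Prime := ⟨hp⟩
  obtain ⟨n, hn⟩ := IsPGroup.exists_card_eq hQ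
  have hn0 : n ≠ 0 := by
    rintro rfl
    have := Finite.one_lt_card (α := Q)
    simp [hn] at this
  obtain ⟨m, rfl⟩ := Nat.exists_eq_succ_of_ne_zero hn0
  obtain ⟨K, hK⟩ := Sylow.exists_subgroup_card_pow_prime (G := Q) p (n := m)
    (by rw [hn]; exact pow_dvd_pow p (Nat.le_succ m))
  have hidx : K.index = p := by
    have h := K.card_mul_index
    rw [hK, hn, pow_succ] at h
    exact Nat.eq_of_mul_eq_mul_left (pow_pos hp.pos m) h
  have : K.Normal := Subgroup.normal_of_index_eq_minFac_card (by
    rw [hidx, hn, hp.pow_minFac (Nat.succ_ne_zero m)])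
  have hq : Nat.card (Q ⧸ K) = p := hidx
  let e := mulEquivOfPrimeCardEq hq hC
  refine ⟨e.toMonoidHom.comp (QuotientGroup.mk' K), ?_⟩
  have : K ≠ ⊤ := by
    rintro rfl
    rw [Subgroup.index_top] at hidx
    exact hp.one_lt.ne hidx
  obtain ⟨q, hqK⟩ : ∃ q, q ∉ K := by
    by_contra! h
    exact this (eq_top_iff.2 fun x _ => h x)
  refine ⟨q, fun h => hqK ?_⟩
  have h' : e (QuotientGroup.mk' K q) = 1 := h
  rw [map_eq_one_iff e e.injective] at h'
  exact (QuotientGroup.eq_one_iff q).1 h'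

/-- The automorphism `h ↦ h * t h` for a central endomorphism with `t ∘ t = 1`. -/
def shearAut {H : Type*} [Group H] (t : H →* H) (hc : ∀ x y, t x * y = y * t x)
    (ht : ∀ x, t (t x) = 1) : MulAut H where
  toFun h := h * t h
  invFun h := h * (t h)⁻¹
  left_inv h := by simp [ht]
  right_inv h := by simp [ht]
  map_mul' x y := by
    rw [map_mul, mul_assoc, mul_assoc]
    congr 1
    rw [← mul_assoc, ← mul_assoc, hc x y]

theorem aut_aux (p : ℕ) (hp : p.Prime)
    (H : Type*) [Group H] [Finite H] (hH : IsPGroup p H)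
    (hHnonab : ¬ ∀ x y : H, x * y = y * x)
    (hHaut : ∀ φ ψ : MulAut H, φ * ψ = ψ * φ)
    (C : Type*) [Group C] (hC : Nat.card C = p)
    (γ : H →* C) (e : C →* H) (hγ : ∀ c, γ (e c) = c) (he : ∀ c y, e c * y = y * e c) : False := by
  have : Fact p.Prime := ⟨hp⟩
  have hCcomm : ∀ a b : C, a * b = b * a := fun a b => by
    rw [← hγ a, ← hγ b, ← map_mul, he, map_mul]
  have : e.range.Normal := ⟨by
    rintro _ ⟨c, rfl⟩ g
    exact ⟨c, by rw [← he, mul_inv_cancel_right]⟩⟩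
  have : Nontrivial (H ⧸ e.range) := by
    by_contra hnt
    rw [not_nontrivial_iff_subsingleton] at hnt
    apply hHnonab
    intro x y
    obtain ⟨c, rfl⟩ := (QuotientGroup.eq_one_iff x).1 (Subsingleton.elim (x : H ⧸ e.range) 1)
    exact he c y
  obtain ⟨f, q, hfq⟩ := exists_hom_aux p hp (H ⧸ e.range) (hH.to_quotient _) C hC
  obtain ⟨h, rfl⟩ := QuotientGroup.mk_surjective q
  let f' : H →* C := f.comp (QuotientGroup.mk' e.range)
  have hf'h : f' h ≠ 1 := hfq
  have hf'e : ∀ c, f' (e c) = 1 := by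
    intro c
    have : ((e c : H) : H ⧸ e.range) = 1 := (QuotientGroup.eq_one_iff _).2 ⟨c, rfl⟩
    change f ((e c : H) : H ⧸ e.range) = 1
    rw [this, map_one]
  -- construct g
  have hsplit : ∀ x, x * (e (γ x))⁻¹ ∈ γ.ker := fun x => by
    rw [MonoidHom.mem_ker, map_mul, map_inv, hγ, mul_inv_cancel]
  have : Nontrivial γ.ker := by
    by_contra hnt
    rw [not_nontrivial_iff_subsingleton] at hnt
    apply hHnonab
    intro x y
    have h1 := congrArg Subtype.val (Subsingleton.elim (⟨_, hsplit x⟩ : γ.ker) 1)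
    have h2 : x = e (γ x) := mul_inv_eq_one.1 h1
    rw [h2]
    exact he _ y
  have : Nontrivial (Subgroup.center γ.ker) := (hH.to_subgroup γ.ker).center_nontrivial
  obtain ⟨n, hn⟩ := IsPGroup.exists_card_eq ((hH.to_subgroup γ.ker).to_subgroup (Subgroup.center γ.ker))
  have hn0 : n ≠ 0 := by
    rintro rfl
    have := Finite.one_lt_card (α := Subgroup.center γ.ker)
    simp [hn] at this
  obtain ⟨z, hz⟩ := exists_prime_orderOf_dvd_card' (G := Subgroup.center γ.ker) p
    (by rw [hn]; exact dvd_pow_self p hn0)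
  have hzc : Nat.card (Subgroup.zpowers z) = p := by rw [Nat.card_zpowers, hz]
  let i := mulEquivOfPrimeCardEq hC hzc
  let s : Subgroup.zpowers z →* H :=
    (γ.ker.subtype.comp (Subgroup.center γ.ker).subtype).comp (Subgroup.zpowers z).subtype
  let g : C →* H := s.comp i.toMonoidHom
  have hginj : ∀ c, g c = 1 → c = 1 := by
    intro c hc
    have h1 : i c = 1 := Subtype.ext (Subtype.ext (Subtype.ext hc))
    exact (map_eq_one_iff i i.injective).1 h1
  have hγg : ∀ c, γ (g c) = 1 := fun c => (i c).1.1.2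
  have hgc : ∀ c y, g c * y = y * g c := by
    intro c y
    have h1 := Subgroup.mem_center_iff.1 (i c).1.2 ⟨_, hsplit y⟩
    have h2 : y * (e (γ y))⁻¹ * g c = g c * (y * (e (γ y))⁻¹) := congrArg Subtype.val h1
    have h3 : y = y * (e (γ y))⁻¹ * e (γ y) := by rw [inv_mul_cancel_right]
    rw [h3, ← mul_assoc, ← h2, mul_assoc _ (g c), ← he, ← mul_assoc]
  let σ := shearAut (e.comp f') (fun x y => he _ y) (fun x => by simp [hf'e])
  let τ := shearAut (g.comp γ) (fun x y => hgc _ y) (fun x => by simp [hγg])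
  have hh : σ (τ h) = τ (σ h) := congrArg (fun φ : MulAut H => φ h) (hHaut σ τ)
  have hh' : (h * g (γ h)) * e (f' (h * g (γ h))) = (h * e (f' h)) * g (γ (h * e (f' h))) := hh
  simp only [map_mul, hγ] at hh'
  have h4 : e (f' (g (γ h))) = g (f' h) := by
    have : h * g (γ h) * e (f' h) * e (f' (g (γ h))) = h * g (γ h) * e (f' h) * g (f' h) := by
      rw [mul_assoc _ (e _) (e _), hh', ← mul_assoc, mul_assoc h (e _), he, ← mul_assoc]
    exact mul_left_cancel this
  have h5 := congrArg γ h4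
  rw [hγ, hγg] at h5
  rw [h5, map_one] at h4
  exact hf'h (hginj _ h4.symm)

/-- If `H` is a finite Miller `p`-group and `C` is cyclic of order `p`, then every automorphism
of `H × C` is central. -/
theorem stmt_12 (p : ℕ) (hp : p.Prime)
    (H : Type*) [Group H] [Finite H] (hH : IsPGroup p H)
    (hHnonab : ¬ ∀ x y : H, x * y = y * x)
    (hHaut : ∀ φ ψ : MulAut H, φ * ψ = ψ * φ)
    (C : Type*) [Group C] [IsCyclic C] (hC : Nat.card C = p) :
    ∀ φ : MulAut (H × C), ∀ g : H × C, g⁻¹ * φ g ∈ Subgroup.center (H × C) := by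
  intro φ
  have : Fact p.Prime := ⟨hp⟩
  have hCcomm : ∀ a b : C, a * b = b * a := fun a b => (IsCyclic.commGroup (α := C)).mul_comm a b
  have hcen : ∀ (c : C) (y : H × C), ((1, c) : H × C) * y = y * (1, c) := by
    rintro c ⟨a, b⟩
    simp [hCcomm c b]
  let α : H →* H := (MonoidHom.fst H C).comp (φ.toMonoidHom.comp (MonoidHom.inl H C))
  have hα : ∀ h, (φ (h, 1)).1 = α h := fun h => rfl
  have hinj : Function.Injective α := by
    rw [injective_iff_map_eq_one]
    by_contra! hcon
    obtain ⟨k, hk, hk1⟩ := hcon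
    let γ : H →* C := (MonoidHom.snd H C).comp (φ.toMonoidHom.comp (MonoidHom.inl H C))
    let e : C →* H := (MonoidHom.fst H C).comp (φ.symm.toMonoidHom.comp (MonoidHom.inr H C))
    let d : C →* C := (MonoidHom.snd H C).comp (φ.symm.toMonoidHom.comp (MonoidHom.inr H C))
    have hed : ∀ c, φ.symm (1, c) = (e c, d c) := fun c => rfl
    have hk2 : φ (k, 1) = (1, γ k) := Prod.ext hk rfl
    have hk3 : φ.symm (1, γ k) = (k, 1) := by rw [← hk2, MulEquiv.symm_apply_apply]
    have hγk : γ k ≠ 1 := by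
      intro h0
      rw [h0] at hk3
      have : φ.symm (1, 1) = 1 := map_one φ.symm
      rw [hk3] at this
      exact hk1 (congrArg Prod.fst this)
    have hdk : d (γ k) = 1 := congrArg Prod.snd hk3
    have hd : ∀ c, d c = 1 := by
      intro c
      obtain ⟨n, rfl⟩ := Subgroup.mem_zpowers_iff.1 (mem_zpowers_of_prime_card (g' := c) hC hγk)
      rw [map_zpow, hdk, one_zpow]
    have hφe : ∀ c, φ (e c, 1) = (1, c) := by
      intro c
      rw [← hd c, ← hed c, MulEquiv.apply_symm_apply]
    refine aut_aux p hp H hH hHnonab hHaut C hC γ e (fun c => congrArg Prod.snd (hφe c)) ?_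
    intro c y
    have h1 : ((e c, 1) : H × C) * (y, 1) = (y, 1) * (e c, 1) := by
      apply φ.injective
      rw [map_mul, map_mul, hφe, hcen]
    exact congrArg Prod.fst h1
  let A : MulAut H := MulEquiv.ofBijective α (Finite.injective_iff_bijective.1 hinj)
  -- A is central
  have hA : ∀ h y, (h⁻¹ * α h) * y = y * (h⁻¹ * α h) := by
    intro h y
    obtain ⟨x, rfl⟩ := A.surjective y
    have h1 : A (h * x * h⁻¹) = h * A x * h⁻¹ :=
      congrArg (fun φ : MulAut H => φ x) (hHaut A (MulAut.conj h))
    rw [map_mul, map_mul, map_inv] at h1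
    change h⁻¹ * A h * A x = A x * (h⁻¹ * A h)
    have h2 : A h * A x = h * A x * h⁻¹ * A h := by rw [← h1]; group
    rw [mul_assoc, h2]; group
  rintro ⟨h, c⟩
  rw [Subgroup.mem_center_iff]
  have hb : ∀ y, (φ (1, c)) * y = y * φ (1, c) := by
    intro y
    obtain ⟨x, rfl⟩ := φ.surjective y
    rw [← map_mul, hcen, map_mul]
  have hdec : φ (h, c) = φ (h, 1) * φ (1, c) := by rw [← map_mul]; simp
  rintro ⟨y, y'⟩
  rw [hdec]
  refine Prod.ext ?_ (hCcomm _ _)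
  change y * (h⁻¹ * (α h * (φ (1, c)).1)) = h⁻¹ * (α h * (φ (1, c)).1) * y
  have hb1 : (φ (1, c)).1 * y = y * (φ (1, c)).1 := congrArg Prod.fst (hb (y, 1))
  rw [← mul_assoc h⁻¹, mul_assoc _ _ y, hb1, ← mul_assoc y, ← mul_assoc (h⁻¹ * α h), hA h y]
end

section
/- Let p be an odd prime, let H be a special p-group with H^p ≤ H', let M ≤ H' be a subgroup of order p, and let G be a finite group containing H as a normal subgroup together with an element w of order p^{m+1} with m ≥ 2 such that G = H⟨w⟩, H ∩ ⟨w⟩ = M = ⟨w^{p^m}⟩, and conjugation by w restricts to a central automorphism of H. Then the subgroup Ω₂(G) generated by all elements of G of order dividing p² equals H⟨w^{p^{m-1}}⟩; in particular H⟨w^{p^{m-1}}⟩ is a characteristic subgroup of G. -/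
open scoped commutatorElement

theorem aux_pow {G : Type*} [Group G] {h u c : G} (e : u * h = h * u * c) (cu : Commute c u)
    (k : ℕ) : u ^ k * h = h * u ^ k * c ^ k := by
  induction k with
  | zero => simp
  | succ k ih =>
    have h1 : c ^ k * u = u * c ^ k := (cu.pow_left k).eq
    calc u ^ (k+1) * h = u ^ k * (u * h) := by rw [pow_succ, mul_assoc]
      _ = (u ^ k * h) * u * c := by rw [e]; group
      _ = h * u ^ k * (c ^ k * u) * c := by rw [ih]; group
      _ = h * u ^ (k+1) * c ^ (k+1) := by rw [h1, pow_succ, pow_succ]; group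

theorem aux_mul_pow_s15 {G : Type*} [Group G] {h u c : G} (e : u * h = h * u * c) (cu : Commute c u)
    (ch : Commute c h) (n : ℕ) : (h * u) ^ n = h ^ n * u ^ n * c ^ (n.choose 2 + 0) := by
  induction n with
  | zero => simp
  | succ n ih =>
    have h1 : c ^ (n.choose 2) * (h * u) = h * u * c ^ (n.choose 2) :=
      ((ch.mul_right cu).pow_left _).eq
    have h2 : c ^ n * u = u * c ^ n := (cu.pow_left n).eq
    have h3 := aux_pow e cu n
    have h4 : (n+1).choose 2 = n + n.choose 2 := by
      rw [Nat.choose_succ_succ' n 1]; simp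
    rw [add_zero] at ih ⊢
    calc (h * u) ^ (n+1) = h ^ n * u ^ n * (c ^ (n.choose 2) * (h * u)) := by
          rw [pow_succ, ih, mul_assoc]
      _ = h ^ n * (u ^ n * h) * u * c ^ (n.choose 2) := by rw [h1]; simp only [mul_assoc]
      _ = h ^ n * h * u ^ n * (c ^ n * u) * c ^ (n.choose 2) := by
          rw [h3]; simp only [mul_assoc]
      _ = _ := by rw [h2, h4, pow_succ, pow_succ, pow_add]; simp only [mul_assoc]

/-- If `H` is a special `p`-group with `H^p ≤ H'`, `M ≤ H'` has order `p`, `G = H⟨w⟩` with `H`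
normal, `o(w) = p^{m+1}`, `m ≥ 2`, `H ∩ ⟨w⟩ = M = ⟨w^{p^m}⟩`, and conjugation by `w` restricts
to a central automorphism of `H`, then `Ω₂(G) = H⟨w^{p^{m-1}}⟩`; in particular
`H⟨w^{p^{m-1}}⟩` is characteristic in `G`. -/
theorem stmt_15 (p : ℕ) (hp : p.Prime) (hodd : Odd p)
    (G : Type*) [Group G] [Finite G] (H : Subgroup G) [H.Normal]
    -- `H` is a special `p`-group
    (hHpgrp : IsPGroup p H)
    (hsp1 : Subgroup.center ↥H = commutator ↥H)
    (hsp2 : frattini ↥H = commutator ↥H)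
    -- `H^p ≤ H'`
    (hpow : Subgroup.closure {x : ↥H | ∃ g : ↥H, g ^ p = x} ≤ commutator ↥H)
    -- `M ≤ H'` of order `p`
    (M : Subgroup ↥H) (hMle : M ≤ commutator ↥H) (hMcard : Nat.card M = p)
    -- `w` of order `p^{m+1}` with `m ≥ 2`, `G = H⟨w⟩`, `H ∩ ⟨w⟩ = M = ⟨w^{p^m}⟩`
    (w : G) (m : ℕ) (hm : 2 ≤ m) (hw : orderOf w = p ^ (m + 1))
    (hgen : H ⊔ Subgroup.zpowers w = ⊤)
    (hint : H ⊓ Subgroup.zpowers w = M.map H.subtype)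
    (hMw : M.map H.subtype = Subgroup.zpowers (w ^ p ^ m))
    -- conjugation by `w` restricts to a central automorphism of `H`
    (hcentral : ∀ h ∈ H, ∀ k ∈ H, Commute (h⁻¹ * (w * h * w⁻¹)) k) :
    Subgroup.closure {g : G | g ^ p ^ 2 = 1} = H ⊔ Subgroup.zpowers (w ^ p ^ (m - 1)) ∧
    (H ⊔ Subgroup.zpowers (w ^ p ^ (m - 1))).Characteristic := by
  have hexp : ∀ x : ↥H, x ∈ commutator ↥H → x ^ p = 1 := by
    intro x hx
    have hx' := hx
    rw [commutator_eq_closure] at hx'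
    induction hx' using Subgroup.closure_induction with
    | mem x hx' =>
      obtain ⟨a, b, rfl⟩ := hx'
      have hc : ∀ y : ↥H, Commute ⁅a, b⁆ y := fun y => by
        rw [← hsp1] at hx
        exact (Subgroup.mem_center_iff.1 hx y).symm
      have e : a * b = b * a * ⁅a, b⁆ := by
        rw [← (hc (b * a)).eq, commutatorElement_def]; group
      have h1 := aux_pow e (hc a) p
      have h2 : a ^ p ∈ Subgroup.center ↥H := by
        rw [hsp1]; exact hpow (Subgroup.subset_closure ⟨a, rfl⟩)
      rw [← Subgroup.mem_center_iff.1 h2 b] at h1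
      simpa using h1
    | one => simp
    | mul x y hx1 hy1 ihx ihy =>
      rw [← commutator_eq_closure] at hx1 hy1
      have : Commute x y := by
        rw [← hsp1] at hy1
        exact Subgroup.mem_center_iff.1 hy1 x
      rw [this.mul_pow, ihx hx1, ihy hy1, one_mul]
    | inv x hx1 ih =>
      rw [← commutator_eq_closure] at hx1
      rw [inv_pow, ih hx1, inv_one]
  have hwc : ∀ x : ↥H, x ∈ commutator ↥H → Commute (x : G) w := by
    intro x hx
    rw [commutator_eq_closure] at hx
    induction hx using Subgroup.closure_induction with
    | mem x hx' =>
      obtain ⟨⟨a, ha⟩, ⟨b, hb⟩, rfl⟩ := hx'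
      have hca := hcentral a ha
      have hcb := hcentral b hb
      have hd : b⁻¹ * (w * b * w⁻¹) ∈ H :=
        H.mul_mem (H.inv_mem hb) (Subgroup.Normal.conj_mem inferInstance b hb w)
      have ea : w * a * w⁻¹ = a * (a⁻¹ * (w * a * w⁻¹)) := by group
      have eb : w * b * w⁻¹ = b * (b⁻¹ * (w * b * w⁻¹)) := by group
      have key : w * ⁅a, b⁆ * w⁻¹ = ⁅a, b⁆ := by
        have : w * ⁅a, b⁆ * w⁻¹ = ⁅w * a * w⁻¹, w * b * w⁻¹⁆ := by
          simp only [commutatorElement_def]; group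
        rw [this, ea, eb]
        generalize a⁻¹ * (w * a * w⁻¹) = c at *
        generalize b⁻¹ * (w * b * w⁻¹) = d at *
        have h1 : c * (b * d) = b * d * c := (hca _ (H.mul_mem hb hd)).eq
        have h2 : d * a⁻¹ = a⁻¹ * d := (hcb _ (H.inv_mem ha)).eq
        simp only [commutatorElement_def]
        calc a * c * (b * d) * (a * c)⁻¹ * (b * d)⁻¹
            = a * (c * (b * d)) * c⁻¹ * a⁻¹ * d⁻¹ * b⁻¹ := by group
          _ = a * b * (d * a⁻¹) * d⁻¹ * b⁻¹ := by rw [h1]; group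
          _ = _ := by rw [h2]; group
      have : w * ⁅a, b⁆ = ⁅a, b⁆ * w := by
        rw [← mul_inv_eq_iff_eq_mul]; exact key
      exact this.symm
    | one => simp
    | mul x y hx1 hy1 ihx ihy => rw [Subgroup.coe_mul]; exact ihx.mul_left ihy
    | inv x hx1 ih => rw [Subgroup.coe_inv]; exact ih.inv_left
  have hHexp : ∀ h ∈ H, h ^ p ^ 2 = 1 := by
    intro h hh
    have h1 := hexp (⟨h, hh⟩ ^ p) (hpow (Subgroup.subset_closure ⟨_, rfl⟩))
    rw [← pow_mul, ← sq] at h1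
    simpa using congrArg Subtype.val h1
  have hmain : Subgroup.closure {g : G | g ^ p ^ 2 = 1}
      = H ⊔ Subgroup.zpowers (w ^ p ^ (m - 1)) := by
    apply le_antisymm
    · rw [Subgroup.closure_le]
      intro g hg
      have hg2 : g ^ p ^ 2 = 1 := hg
      have hgt : g ∈ H ⊔ Subgroup.zpowers w := by rw [hgen]; trivial
      obtain ⟨h, hh, u, hu, rfl⟩ := Subgroup.mem_sup_of_normal_left.1 hgt
      obtain ⟨k, rfl⟩ := (mem_powers_iff_mem_zpowers.2 hu)
      simp only at hg2 ⊢
      have hcH : h⁻¹ * (w * h * w⁻¹) ∈ H :=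
        H.mul_mem (H.inv_mem hh) (Subgroup.Normal.conj_mem inferInstance h hh w)
      have hcc : (⟨_, hcH⟩ : ↥H) ∈ commutator ↥H := by
        rw [← hsp1, Subgroup.mem_center_iff]
        intro y
        exact Subtype.ext (hcentral h hh y y.2).eq.symm
      have hcp : (h⁻¹ * (w * h * w⁻¹)) ^ p = 1 := by
        simpa using congrArg Subtype.val (hexp _ hcc)
      have hcw : Commute (h⁻¹ * (w * h * w⁻¹)) w := hwc _ hcc
      have hch : Commute (h⁻¹ * (w * h * w⁻¹)) h := hcentral h hh h hh
      have e : w * h = h * w * (h⁻¹ * (w * h * w⁻¹)) := by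
        rw [mul_assoc h w, ← hcw.eq]; group
      generalize h⁻¹ * (w * h * w⁻¹) = c at *
      have e2 := aux_pow e hcw k
      have e3 := aux_mul_pow_s15 e2 (hcw.pow_pow k k) (hch.pow_left k) (p ^ 2)
      have hdvd : p ∣ (p ^ 2).choose 2 := by
        apply hp.dvd_choose_pow (by norm_num)
        have := hp.two_le
        nlinarith
      obtain ⟨q, hq⟩ := hdvd
      have e4 : (c ^ k) ^ ((p ^ 2).choose 2 + 0) = 1 := by
        rw [add_zero, hq, ← pow_mul, mul_left_comm, pow_mul, hcp, one_pow]
      rw [e4, hHexp h hh, hg2, one_mul, mul_one, ← pow_mul] at e3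
      have h5 := orderOf_dvd_of_pow_eq_one e3.symm
      rw [hw, show m + 1 = (m - 1) + 2 by omega, pow_add] at h5
      obtain ⟨j, rfl⟩ := Nat.dvd_of_mul_dvd_mul_right (pow_pos hp.pos 2) h5
      refine Subgroup.mul_mem_sup hh ?_
      rw [pow_mul]
      exact Subgroup.npow_mem_zpowers _ _
    · refine sup_le (fun h hh => Subgroup.subset_closure (hHexp h hh)) ?_
      rw [Subgroup.zpowers_le]
      apply Subgroup.subset_closure
      change (w ^ p ^ (m - 1)) ^ p ^ 2 = 1
      rw [← pow_mul, ← pow_add, show m - 1 + 2 = m + 1 by omega, ← hw, pow_orderOf_eq_one]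
  refine ⟨hmain, ?_⟩
  rw [← hmain, Subgroup.characteristic_iff_map_le]
  intro φ
  rw [Subgroup.map_le_iff_le_comap, Subgroup.closure_le]
  intro g hg
  apply Subgroup.subset_closure
  have hg2 : g ^ p ^ 2 = 1 := hg
  change (φ g) ^ p ^ 2 = 1
  rw [← map_pow, hg2, map_one]
end

section
/- Let p be an odd prime, let H be a finite special p-group, let M ≤ H' be a subgroup of order p, and let G be a finite group containing H as a subgroup together with an element z of order p² commuting with every element of H, such that G = H⟨z⟩ and H ∩ ⟨z⟩ = M. Then G' = H', Φ(G) = Φ(H), Z(G) = Z(H)⟨z⟩, and consequently G' = Φ(G) < Z(G) (strict containment). -/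
open scoped commutatorElement

lemma pow_mem_coatom_aux (p : ℕ) (hp : p.Prime) (H : Type*) [Group H] [Finite H]
    (hH : IsPGroup p H) (x : H) : x ^ p ∈ frattini H := by
  have := Fact.mk hp
  have : Group.IsNilpotent H := hH.isNilpotent
  rw [frattini, Order.radical]
  simp only [Subgroup.mem_iInf]
  intro K hK
  have hKn : K.Normal := Subgroup.NormalizerCondition.normal_of_coatom K
    Group.normalizerCondition_of_isNilpotent hK
  by_contra hx
  have htop : K ⊔ Subgroup.zpowers (x ^ p) = ⊤ := by
    apply hK.2
    rw [left_lt_sup]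
    intro h
    exact hx (h (Subgroup.mem_zpowers _))
  have hxm : x ∈ K ⊔ Subgroup.zpowers (x ^ p) := by rw [htop]; trivial
  rw [Subgroup.mem_sup_of_normal_left] at hxm
  obtain ⟨k, hk, y, hy, hxy⟩ := hxm
  obtain ⟨i, rfl⟩ := Subgroup.mem_zpowers_iff.1 hy
  have h1 : x ^ (1 - (p : ℤ) * i) ∈ K := by
    have : x ^ (1 - (p : ℤ) * i) = k := by
      rw [zpow_sub, zpow_one, zpow_mul, zpow_natCast]
      exact mul_inv_eq_of_eq_mul hxy.symm
    rwa [this]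
  obtain ⟨n, hn⟩ := hH x
  have hcop : IsCoprime (1 - (p : ℤ) * i) ((p : ℤ) ^ n) := by
    apply IsCoprime.pow_right
    exact ⟨1, i, by ring⟩
  obtain ⟨a, b, hab⟩ := hcop
  have h2 : x = (x ^ (1 - (p : ℤ) * i)) ^ a := by
    have h3 : x ^ (a * (1 - (p : ℤ) * i) + b * (p : ℤ) ^ n) = x := by rw [hab, zpow_one]
    have h4 : x ^ (b * (p : ℤ) ^ n) = 1 := by
      rw [mul_comm, zpow_mul]
      have : x ^ ((p : ℤ) ^ n) = 1 := by exact_mod_cast hn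
      rw [this, one_zpow]
    rw [zpow_add, h4, mul_one, mul_comm, zpow_mul] at h3
    exact h3.symm
  have hxK : x ∈ K := by rw [h2]; exact K.zpow_mem h1 a
  exact hx (K.pow_mem hxK p)

lemma frattini_le_aux (p : ℕ) (hp : p.Prime) (G : Type*) [Group G] [Finite G]
    (N : Subgroup G) (hN : commutator G ≤ N) (hpow : ∀ g : G, g ^ p ∈ N) :
    frattini G ≤ N := by
  intro g hg
  by_contra hgN
  obtain ⟨K, hNK, hK⟩ := (Set.toFinite {K : Subgroup G | N ≤ K ∧ g ∉ K}).exists_le_maximal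
    (show N ∈ {K : Subgroup G | N ≤ K ∧ g ∉ K} from ⟨le_rfl, hgN⟩)
  have hlt : ∀ L : Subgroup G, K < L → g ∈ L := by
    intro L hL
    by_contra h
    exact hL.not_ge (hK.2 ⟨hNK.trans hL.le, h⟩ hL.le)
  have hKn : K.Normal := Subgroup.Normal.of_commutator_le G (hN.trans hNK)
  have hco : IsCoatom K := by
    refine ⟨fun h => hK.1.2 (h ▸ Subgroup.mem_top g), fun L hL => ?_⟩
    rw [eq_top_iff]
    intro x _
    by_cases hx : x ∈ K
    · exact hL.le hx
    have hgx : g ∈ K ⊔ Subgroup.zpowers x := by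
      apply hlt
      rw [left_lt_sup]
      intro h
      exact hx (h (Subgroup.mem_zpowers _))
    rw [Subgroup.mem_sup_of_normal_left] at hgx
    obtain ⟨k, hk, y, hy, hxy⟩ := hgx
    obtain ⟨i, rfl⟩ := Subgroup.mem_zpowers_iff.1 hy
    have hgL := hlt L hL
    have hxi : x ^ i ∈ L := by
      have := L.mul_mem (L.inv_mem (hL.le hk)) hgL
      rwa [← hxy, inv_mul_cancel_left] at this
    have hxp : x ^ (p : ℤ) ∈ K := by
      rw [zpow_natCast]; exact hNK (hpow x)
    have hcop : IsCoprime i (p : ℤ) := by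
      rw [isCoprime_comm, (Nat.prime_iff_prime_int.1 hp).coprime_iff_not_dvd]
      rintro ⟨c, rfl⟩
      apply hK.1.2
      rw [← hxy]
      apply K.mul_mem hk
      rw [zpow_mul]
      exact K.zpow_mem hxp c
    obtain ⟨a, b, hab⟩ := hcop
    have h3 : x ^ (a * i + b * (p : ℤ)) = x := by rw [hab, zpow_one]
    rw [← h3, zpow_add, mul_comm a, mul_comm b, zpow_mul, zpow_mul]
    exact L.mul_mem (L.zpow_mem hxi a) (L.zpow_mem (hL.le hxp) b)
  exact hK.1.2 (frattini_le_coatom hco hg)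

lemma commutator_le_frattini_aux (G : Type*) [Group G]
    (hc : commutator G ≤ Subgroup.center G) : commutator G ≤ frattini G := by
  rw [frattini, Order.radical]
  simp only [le_iInf_iff]
  intro K hK
  by_contra hx
  have htop : K ⊔ commutator G = ⊤ := by
    apply hK.2
    rw [left_lt_sup]
    exact hx
  apply hx
  rw [commutator_def, Subgroup.commutator_le]
  intro a _ b _
  have ha : a ∈ K ⊔ commutator G := by rw [htop]; trivial
  have hb : b ∈ K ⊔ commutator G := by rw [htop]; trivial
  rw [Subgroup.mem_sup_of_normal_right] at ha hb
  obtain ⟨k, hk, y, hy, rfl⟩ := ha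
  obtain ⟨l, hl, w, hw, rfl⟩ := hb
  have hy' := Subgroup.mem_center_iff.1 (hc hy)
  have hw' := Subgroup.mem_center_iff.1 (hc hw)
  have : ⁅k * y, l * w⁆ = ⁅k, l⁆ := by
    simp only [commutatorElement_def, mul_inv_rev]
    calc k * y * (l * w) * (y⁻¹ * k⁻¹) * (w⁻¹ * l⁻¹)
        = k * (y * (l * w)) * (y⁻¹ * k⁻¹) * (w⁻¹ * l⁻¹) := by group
      _ = k * l * (w * k⁻¹) * w⁻¹ * l⁻¹ := by rw [← hy']; group
      _ = k * l * k⁻¹ * l⁻¹ := by rw [← hw']; group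
  rw [this]
  exact K.mul_mem (K.mul_mem (K.mul_mem hk hl) (K.inv_mem hk)) (K.inv_mem hl)

/-- If `H` is a finite special `p`-group, `M ≤ H'` has order `p`, and `G = H⟨z⟩` with `z` of
order `p²` commuting with every element of `H` and `H ∩ ⟨z⟩ = M`, then `G' = H'`,
`Φ(G) = Φ(H)`, `Z(G) = Z(H)⟨z⟩`, and consequently `G' = Φ(G) < Z(G)`. -/
theorem stmt_16 (p : ℕ) (hp : p.Prime) (hodd : Odd p)
    (G : Type*) [Group G] [Finite G] (H : Subgroup G)
    -- `H` is a special `p`-group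
    (hHpgrp : IsPGroup p H)
    (hsp1 : Subgroup.center ↥H = commutator ↥H)
    (hsp2 : frattini ↥H = commutator ↥H)
    -- `M ≤ H'` of order `p`
    (M : Subgroup ↥H) (hMle : M ≤ commutator ↥H) (hMcard : Nat.card M = p)
    -- `z` of order `p²` commuting with every element of `H`, `G = H⟨z⟩`, `H ∩ ⟨z⟩ = M`
    (z : G) (hz : orderOf z = p ^ 2)
    (hzcomm : ∀ h ∈ H, Commute z h)
    (hgen : H ⊔ Subgroup.zpowers z = ⊤)
    (hint : H ⊓ Subgroup.zpowers z = M.map H.subtype) :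
    commutator G = (commutator ↥H).map H.subtype ∧
    frattini G = (frattini ↥H).map H.subtype ∧
    Subgroup.center G = (Subgroup.center ↥H).map H.subtype ⊔ Subgroup.zpowers z ∧
    commutator G = frattini G ∧
    frattini G < Subgroup.center G := by
  have hp0 : 0 < p := hp.pos
  have hzc : z ∈ Subgroup.center G := by
    have : (⊤ : Subgroup G) ≤ Subgroup.centralizer {z} := by
      rw [← hgen, sup_le_iff]
      constructor
      · intro h hh
        rw [Subgroup.mem_centralizer_singleton_iff]
        exact (hzcomm h hh).symm.eq
      · rw [Subgroup.zpowers_le, Subgroup.mem_centralizer_singleton_iff]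
    rw [Subgroup.mem_center_iff]
    intro g
    have := this (Subgroup.mem_top g)
    rwa [Subgroup.mem_centralizer_singleton_iff] at this
  have hzn : (Subgroup.zpowers z).Normal := by
    refine ⟨fun n hn g => ?_⟩
    have hn' : n ∈ Subgroup.center G := (Subgroup.zpowers_le.2 hzc) hn
    rw [Subgroup.mem_center_iff.1 hn' g, mul_inv_cancel_right]
    exact hn
  have hdec : ∀ g : G, ∃ h ∈ H, ∃ w ∈ Subgroup.zpowers z, h * w = g := by
    intro g
    have : g ∈ H ⊔ Subgroup.zpowers z := by rw [hgen]; trivial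
    rwa [Subgroup.mem_sup_of_normal_right] at this
  have hzw : ∀ w ∈ Subgroup.zpowers z, ∀ g : G, g * w = w * g := fun w hw =>
    Subgroup.mem_center_iff.1 ((Subgroup.zpowers_le.2 hzc) hw)
  have hcent : ∀ x ∈ (Subgroup.center ↥H).map H.subtype, x ∈ Subgroup.center G := by
    rintro _ ⟨x, hx, rfl⟩
    rw [Subgroup.mem_center_iff]
    intro g
    obtain ⟨h, hh, w, hw, rfl⟩ := hdec g
    have h1 : h * (x : G) = x * h :=
      congrArg Subtype.val (Subgroup.mem_center_iff.1 hx ⟨h, hh⟩)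
    have h2 := hzw w hw x
    change h * w * (x : G) = x * (h * w)
    rw [mul_assoc, ← h2, ← mul_assoc, h1, mul_assoc]
  have hG' : commutator G = (commutator ↥H).map H.subtype := by
    apply le_antisymm
    · rw [commutator_def, Subgroup.commutator_le]
      intro a _ b _
      obtain ⟨k, hk, y, hy, rfl⟩ := hdec a
      obtain ⟨l, hl, w, hw, rfl⟩ := hdec b
      have hy' := hzw y hy
      have hw' := hzw w hw
      have : ⁅k * y, l * w⁆ = ⁅k, l⁆ := by
        simp only [commutatorElement_def, mul_inv_rev]
        calc k * y * (l * w) * (y⁻¹ * k⁻¹) * (w⁻¹ * l⁻¹)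
            = k * (y * (l * w)) * (y⁻¹ * k⁻¹) * (w⁻¹ * l⁻¹) := by group
          _ = k * l * (w * k⁻¹) * w⁻¹ * l⁻¹ := by rw [← hy']; group
          _ = k * l * k⁻¹ * l⁻¹ := by rw [← hw']; group
      rw [this]
      exact ⟨⁅(⟨k, hk⟩ : H), ⟨l, hl⟩⁆,
        Subgroup.commutator_mem_commutator (Subgroup.mem_top _) (Subgroup.mem_top _), rfl⟩
    · rw [commutator_def, commutator_def, Subgroup.map_commutator]
      exact Subgroup.commutator_mono le_top le_top
  have hMcard' : Nat.card (M.map H.subtype) = p := by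
    rw [Subgroup.card_map_of_injective H.subtype_injective, hMcard]
  have hMz : M.map H.subtype ≤ Subgroup.zpowers (z ^ p) := by
    intro m hm
    have hmz : m ∈ H ⊓ Subgroup.zpowers z := by rw [hint]; exact hm
    obtain ⟨k, rfl⟩ := Subgroup.mem_zpowers_iff.1 hmz.2
    have h1 : (z ^ k) ^ p = 1 := by
      have := congrArg Subtype.val (pow_card_eq_one' (x := (⟨_, hm⟩ : M.map H.subtype)))
      rw [hMcard'] at this
      exact this
    rw [← zpow_natCast, ← zpow_mul, ← orderOf_dvd_iff_zpow_eq_one, hz] at h1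
    have h2 : (p : ℤ) * p ∣ k * p := by
      have : ((p ^ 2 : ℕ) : ℤ) = p * p := by push_cast; ring
      rwa [this] at h1
    obtain ⟨c, rfl⟩ := Int.dvd_of_mul_dvd_mul_right (by exact_mod_cast hp0.ne') h2
    rw [zpow_mul, zpow_natCast]
    exact Subgroup.zpow_mem _ (Subgroup.mem_zpowers _) c
  have hzpcard : Nat.card (Subgroup.zpowers (z ^ p)) = p := by
    rw [Nat.card_zpowers, orderOf_pow, hz, Nat.gcd_eq_right (Dvd.intro_left (p ^ 1) (by ring)),
      pow_two, Nat.mul_div_cancel _ hp0]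
  have hMeq : M.map H.subtype = Subgroup.zpowers (z ^ p) :=
    Subgroup.eq_of_le_of_card_ge hMz (by rw [hMcard', hzpcard])
  have hzp : z ^ p ∈ commutator G := by
    rw [hG']
    apply Subgroup.map_mono hMle
    rw [hMeq]
    exact Subgroup.mem_zpowers _
  have hPhi1 : frattini G ≤ commutator G := by
    apply frattini_le_aux p hp G _ le_rfl
    intro g
    obtain ⟨h, hh, w, hw, rfl⟩ := hdec g
    obtain ⟨k, rfl⟩ := Subgroup.mem_zpowers_iff.1 hw
    have hcm : Commute h (z ^ k) := hzw _ hw h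
    rw [hcm.mul_pow]
    apply Subgroup.mul_mem
    · rw [hG', ← hsp2]
      exact ⟨(⟨h, hh⟩ : H) ^ p, pow_mem_coatom_aux p hp H hHpgrp _, rfl⟩
    · have : (z ^ k) ^ p = (z ^ p) ^ k := by
        rw [← zpow_natCast, ← zpow_natCast, ← zpow_mul, ← zpow_mul, mul_comm]
      rw [this]
      exact Subgroup.zpow_mem _ hzp k
  have hG'c : commutator G ≤ Subgroup.center G := by
    rw [hG', ← hsp1]
    exact hcent
  have hPhi : commutator G = frattini G :=
    le_antisymm (commutator_le_frattini_aux G hG'c) hPhi1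
  refine ⟨hG', by rw [← hPhi, hsp2, hG'], ?_, hPhi, ?_⟩
  · apply le_antisymm
    · intro g hg
      obtain ⟨h, hh, w, hw, rfl⟩ := hdec g
      apply Subgroup.mul_mem_sup _ hw
      refine ⟨⟨h, hh⟩, ?_, rfl⟩
      have hhc : h ∈ Subgroup.center G := by
        have := Subgroup.mul_mem _ hg (Subgroup.inv_mem _ ((Subgroup.zpowers_le.2 hzc) hw))
        rwa [mul_inv_cancel_right] at this
      rw [SetLike.mem_coe, Subgroup.mem_center_iff]
      intro x
      exact Subtype.ext (Subgroup.mem_center_iff.1 hhc x)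
    · exact sup_le hcent (Subgroup.zpowers_le.2 hzc)
  · rw [← hPhi]
    refine lt_of_le_of_ne hG'c fun h => ?_
    have hzH : z ∈ H := by
      have : z ∈ commutator G := by rw [h]; exact hzc
      rw [hG'] at this
      exact Subgroup.map_subtype_le _ this
    have hzM : z ∈ M.map H.subtype := by
      rw [← hint]
      exact ⟨hzH, Subgroup.mem_zpowers z⟩
    have h1 : z ^ p = 1 := by
      have := congrArg Subtype.val (pow_card_eq_one' (x := (⟨_, hzM⟩ : M.map H.subtype)))
      rw [hMcard'] at this
      exact this
    have h2 := Nat.le_of_dvd hp0 (orderOf_dvd_of_pow_eq_one h1)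
    rw [hz] at h2
    nlinarith [hp.two_le]
end

section
/- Let p be a prime and let H be a finite special Miller p-group. Then Aut(H) is elementary abelian: every automorphism of H is central, acts trivially on H', and has order dividing p. -/
open scoped commutatorElement

theorem pow_p_mem_frattini_aux (p : ℕ) (hp : p.Prime) (H : Type*) [Group H]
    (hHpgrp : IsPGroup p H) (hsp2 : frattini H = commutator H) (a : H) :
    a ^ p ∈ frattini H := by
  rw [frattini, Order.radical]
  simp only [Subgroup.mem_iInf]
  intro M hM
  by_contra hn
  have hM' : IsCoatom M := hM
  have hle : commutator H ≤ M := hsp2 ▸ frattini_le_coatom hM'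
  have hnorm : M.Normal := by
    constructor
    intro m hm x
    have h1 : ⁅x, m⁆ ∈ M := hle (Subgroup.commutator_mem_commutator (Subgroup.mem_top _)
      (Subgroup.mem_top _))
    have := M.mul_mem h1 hm
    simpa [commutatorElement_def] using this
  have htop : M ⊔ Subgroup.zpowers (a ^ p) = ⊤ := by
    apply hM'.2
    refine lt_of_le_of_ne le_sup_left ?_
    intro h
    apply hn
    rw [h]
    exact Subgroup.mem_sup_right (Subgroup.mem_zpowers _)
  have ha : a ∈ M ⊔ Subgroup.zpowers (a ^ p) := htop ▸ Subgroup.mem_top a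
  rw [Subgroup.mem_sup_of_normal_left] at ha
  obtain ⟨m, hm, z, ⟨n, rfl⟩, hz⟩ := ha
  obtain ⟨k, hk⟩ := hHpgrp a
  have h1 : a ^ (1 - (p : ℤ) * n) ∈ M := by
    have : a ^ (1 - (p : ℤ) * n) = m := by
      rw [zpow_sub, zpow_mul, zpow_natCast, zpow_one, mul_inv_eq_iff_eq_mul]
      exact hz.symm
    rwa [this]
  have hc : IsCoprime (1 - (p : ℤ) * n) ((p : ℤ) ^ k) := by
    apply IsCoprime.pow_right
    exact ⟨1, n, by ring⟩
  obtain ⟨u, v, huv⟩ := hc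
  have h2 : a ∈ M := by
    have e : a = (a ^ (1 - (p : ℤ) * n)) ^ u * (a ^ ((p : ℤ) ^ k)) ^ v := by
      rw [← zpow_mul, ← zpow_mul, ← zpow_add, mul_comm _ u, mul_comm _ v, huv, zpow_one]
    have e2 : a ^ ((p : ℤ) ^ k) = 1 := by
      rw [← hk]; exact_mod_cast zpow_natCast a (p ^ k)
    rw [e, e2, one_zpow, mul_one]
    exact M.zpow_mem h1 u
  exact hn (M.pow_mem h2 p)

/-- If `H` is a finite special Miller `p`-group, then `Aut(H)` is elementary abelian: every
automorphism of `H` is central, acts trivially on `H'`, and has order dividing `p`. -/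
theorem stmt_19 (p : ℕ) (hp : p.Prime)
    (H : Type*) [Group H] [Finite H]
    -- `H` is a special Miller `p`-group
    (hHpgrp : IsPGroup p H)
    (hsp1 : Subgroup.center H = commutator H)
    (hsp2 : frattini H = commutator H)
    (hHnonab : ¬ ∀ x y : H, x * y = y * x)
    (hHaut : ∀ φ ψ : MulAut H, φ * ψ = ψ * φ) :
    ∀ φ : MulAut H,
      (∀ g : H, g⁻¹ * φ g ∈ Subgroup.center H) ∧
      (∀ g ∈ commutator H, φ g = g) ∧
      φ ^ p = 1 := by
  intro φ
  have hcen : ∀ g : H, g⁻¹ * φ g ∈ Subgroup.center H := by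
    intro g
    rw [Subgroup.mem_center_iff]
    intro x
    have h := DFunLike.congr_fun (hHaut φ (MulAut.conj g)) (φ.symm x)
    simp only [MulAut.mul_apply, MulAut.conj_apply, map_mul, map_inv,
      MulEquiv.apply_symm_apply] at h
    -- φ g * x * (φ g)⁻¹ = g * x * g⁻¹
    have h2 := congrArg (fun y => g⁻¹ * y * φ g) h
    simp only [mul_assoc, inv_mul_cancel_left, inv_mul_cancel, mul_one] at h2
    rw [mul_assoc, h2]
  have hfix : ∀ g ∈ commutator H, φ g = g := by
    have : commutator H ≤ MonoidHom.eqLocus φ.toMonoidHom (MonoidHom.id H) := by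
      rw [commutator_eq_closure, Subgroup.closure_le]
      rintro _ ⟨a, b, rfl⟩
      change φ ⁅a, b⁆ = ⁅a, b⁆
      have ha := Subgroup.mem_center_iff.1 (hcen a)
      have hb := Subgroup.mem_center_iff.1 (hcen b)
      obtain ⟨z, hz⟩ : ∃ z, z = a⁻¹ * φ a := ⟨_, rfl⟩
      obtain ⟨w, hw⟩ : ∃ w, w = b⁻¹ * φ b := ⟨_, rfl⟩
      rw [← hz] at ha
      rw [← hw] at hb
      have ea : φ a = a * z := by rw [hz]; group
      have eb : φ b = b * w := by rw [hw]; group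
      rw [map_commutatorElement, ea, eb]
      simp only [commutatorElement_def, mul_inv_rev]
      calc a * z * (b * w) * (z⁻¹ * a⁻¹) * (w⁻¹ * b⁻¹)
          = a * (z * (b * w)) * z⁻¹ * a⁻¹ * w⁻¹ * b⁻¹ := by group
        _ = a * b * (w * a⁻¹) * w⁻¹ * b⁻¹ := by rw [← ha]; group
        _ = a * b * a⁻¹ * b⁻¹ := by rw [← hb]; group
    exact fun g hg => this hg
  refine ⟨hcen, hfix, ?_⟩
  have htor : ∀ g ∈ commutator H, g ^ p = 1 := by
    intro g hg
    have hg' := hg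
    rw [commutator_eq_closure] at hg
    have key : g ∈ Subgroup.center H ∧ g ^ p = 1 := by
      induction hg using Subgroup.closure_induction with
      | mem x hx =>
        obtain ⟨a, b, rfl⟩ := hx
        have hcc : ⁅a, b⁆ ∈ Subgroup.center H := by
          rw [hsp1]
          exact Subgroup.commutator_mem_commutator (Subgroup.mem_top _) (Subgroup.mem_top _)
        refine ⟨hcc, ?_⟩
        have hbp : b ^ p ∈ Subgroup.center H := by
          rw [hsp1, ← hsp2]
          exact pow_p_mem_frattini_aux p hp H hHpgrp hsp2 b
        have e1 : a * b * a⁻¹ = ⁅a, b⁆ * b := by simp [commutatorElement_def]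
        have hcomm : Commute ⁅a, b⁆ b := (Subgroup.mem_center_iff.1 hcc b).symm
        have e2 := congrArg (· ^ p) e1
        simp only [conj_pow, hcomm.mul_pow] at e2
        rw [Subgroup.mem_center_iff.1 hbp a, mul_inv_cancel_right] at e2
        exact (left_eq_mul.1 (by rwa [Subgroup.mem_center_iff.1 hbp] at e2))
      | one => exact ⟨Subgroup.one_mem _, one_pow _⟩
      | mul x y _ _ hx hy =>
        have hx := hx (by rw [commutator_eq_closure]; assumption)
        have hy := hy (by rw [commutator_eq_closure]; assumption)
        refine ⟨Subgroup.mul_mem _ hx.1 hy.1, ?_⟩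
        have hcomm : Commute x y := Subgroup.mem_center_iff.1 hy.1 x
        rw [hcomm.mul_pow, hx.2, hy.2, one_mul]
      | inv x _ hx =>
        have hx := hx (by rw [commutator_eq_closure]; assumption)
        exact ⟨Subgroup.inv_mem _ hx.1, by rw [inv_pow, hx.2, inv_one]⟩
    exact key.2
  ext g
  have hz : g⁻¹ * φ g ∈ commutator H := hsp1 ▸ hcen g
  have hpow : ∀ n : ℕ, (φ ^ n) g = g * (g⁻¹ * φ g) ^ n := by
    intro n
    induction n with
    | zero => simp
    | succ n ih =>
      rw [pow_succ', MulAut.mul_apply, ih, map_mul, map_pow, hfix _ hz, pow_succ', ← mul_assoc,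
        mul_inv_cancel_left]
  rw [hpow, htor _ hz]
  simp
end
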